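/- Let X be a topological space and let E be a topological real vector bundle over X whose model fiber F is a finite-dimensional real normed space. Let q₀ and q₁ be continuous real-valued functions on the total space of E restricting to positive-definite quadratic forms on each fiber. Then there exists a continuous map Φ from (total space of E) × [0,1] to the total space of E such that: for every t ∈ [0,1] and x ∈ X, the map v ↦ Φ(v, t) sends the fiber E_x into E_x and restricts to a linear automorphism of E_x; Φ(v, 0) = v for all v; and q₀(v) = q₁(Φ(v, 1)) for all v in the total space. In particular, any two positive-definite quadratic forms on E are isometric via a gauge transformation lying in the path component of the identity of the gauge group of E. -/

import Mathlib

open scoped InnerProductSpace Topology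
open Filter Set

namespace LinearMap.IsPositive

variable {V : Type*} [NormedAddCommGroup V] [InnerProductSpace ℝ V] [FiniteDimensional ℝ V]

/-- A positive operator on a finite-dimensional inner product space has a positive square root. -/
theorem exists_isPositive_comp_self_eq {A : V →ₗ[ℝ] V} (hA : A.IsPositive) :
    ∃ S : V →ₗ[ℝ] V, S.IsPositive ∧ S ∘ₗ S = A := by
  let b := hA.isSymmetric.eigenvectorBasis rfl
  let μ := hA.isSymmetric.eigenvalues rfl
  have hAb (i) : A (b i) = μ i • b i := hA.isSymmetric.apply_eigenvectorBasis rfl i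
  have hμ (i) : 0 ≤ μ i := by
    have h := hA.re_inner_nonneg_left (b i)
    simpa [hAb, inner_smul_left, b.orthonormal.1 i] using h
  let S : V →ₗ[ℝ] V := b.toBasis.constr ℝ fun i => √(μ i) • b i
  have hSb (i) : S (b i) = √(μ i) • b i := by
    rw [← b.coe_toBasis]
    exact b.toBasis.constr_basis ℝ _ i
  have hS (v) : S v = ∑ i, (√(μ i) * ⟪b i, v⟫_ℝ) • b i := by
    conv_lhs => rw [← b.sum_repr' v]
    simp [hSb, smul_smul, mul_comm]
  have hinner (v w) : ⟪S v, w⟫_ℝ = ∑ i, √(μ i) * (⟪b i, v⟫_ℝ * ⟪b i, w⟫_ℝ) := by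
    simp [hS, sum_inner, inner_smul_left, mul_assoc]
  refine ⟨S, ⟨fun v w => ?_, fun v => ?_⟩, b.toBasis.ext fun i => ?_⟩
  · rw [real_inner_comm (S w) v, hinner, hinner]
    simp only [mul_comm]
  · rw [hinner, RCLike.re_to_real]
    exact Finset.sum_nonneg fun i _ => mul_nonneg (Real.sqrt_nonneg _) (mul_self_nonneg _)
  · simp [hSb, hAb, smul_smul, Real.mul_self_sqrt (hμ i)]

/-- Positive square roots are unique. -/
theorem eq_of_comp_self_eq {S T : V →ₗ[ℝ] V} (hS : S.IsPositive) (hT : T.IsPositive)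
    (h : S ∘ₗ S = T ∘ₗ T) : S = T := by
  have hD : (S - T).IsSymmetric := hS.isSymmetric.sub hT.isSymmetric
  refine (hD.eigenvectorBasis rfl).toBasis.ext fun i => ?_
  set u := hD.eigenvectorBasis rfl i with hu
  set c := hD.eigenvalues rfl i with hc
  have hDu : S u - T u = c • u := hD.apply_eigenvectorBasis rfl i
  have hSu : S u = T u + c • u := by rw [← hDu]; abel
  have hsq : S (S u) = T (T u) := LinearMap.congr_fun h u
  have hS0 : 0 ≤ ⟪S u, u⟫_ℝ := hS.2 u
  have hT0 : 0 ≤ ⟪T u, u⟫_ℝ := hT.2 u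
  have huu : ⟪u, u⟫_ℝ = 1 := by
    rw [real_inner_self_eq_norm_sq, hu, (hD.eigenvectorBasis rfl).orthonormal.1 i, one_pow]
  have hdiff : ⟪S u, u⟫_ℝ = ⟪T u, u⟫_ℝ + c := by
    rw [hSu, inner_add_left, inner_smul_left, huu]; simp
  have hsum : c * (⟪S u, u⟫_ℝ + ⟪T u, u⟫_ℝ) = 0 := by
    have h1 : ⟪S u, S u⟫_ℝ = ⟪T u, T u⟫_ℝ := by
      rw [← hS.isSymmetric (S u) u, ← hT.isSymmetric (T u) u, hsq]
    rw [hdiff]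
    rw [hSu] at h1
    simp only [inner_add_left, inner_add_right, inner_smul_left, inner_smul_right, huu,
      real_inner_comm (T u) u, conj_trivial] at h1
    linarith
  have hc0 : c = 0 := by
    rcases mul_eq_zero.1 hsum with h0 | h0
    · exact h0
    · linarith
  simpa [hc0, ← hu] using hSu

end LinearMap.IsPositive

namespace QuadraticMap

/-- `S` is self-adjoint and positive for `Q₁`, and pulls `Q₁` back to `Q₀`. -/
structure IsPositiveIsometry {V : Type*} [AddCommGroup V] [Module ℝ V]
    (Q₀ Q₁ : QuadraticForm ℝ V) (S : V →ₗ[ℝ] V) : Prop where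
  polar_left (v w : V) : polar Q₁ (S v) w = polar Q₁ v (S w)
  nonneg (v : V) : 0 ≤ polar Q₁ (S v) v
  map_apply (v : V) : Q₁ (S v) = Q₀ v

section Algebra

variable {V : Type*} [AddCommGroup V] [Module ℝ V]

/-- The inner product whose norm squared is `2 Q`. -/
@[reducible]
noncomputable def polarInnerCore (Q : QuadraticForm ℝ V) (hQ : Q.PosDef) :
    InnerProductSpace.Core ℝ V where
  inner v w := polar Q v w
  conj_inner_symm v w := by simp [polar_comm Q w v]
  re_inner_nonneg v := by simpa [polar_self] using hQ.nonneg v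
  add_left u v w := polar_add_left Q u v w
  smul_left v w r := by simp [polar_smul_left]
  definite v hv := by
    refine hQ.anisotropic v ?_
    simpa [polar_self] using hv

variable {Q₀ Q₁ : QuadraticForm ℝ V}

theorem PosDef.eq_of_isPositiveIsometry [FiniteDimensional ℝ V] (h₁ : Q₁.PosDef)
    {S T : V →ₗ[ℝ] V} (hS : IsPositiveIsometry Q₀ Q₁ S) (hT : IsPositiveIsometry Q₀ Q₁ T) :
    S = T := by
  let : NormedAddCommGroup V := (polarInnerCore Q₁ h₁).toNormedAddCommGroup
  let : InnerProductSpace ℝ V := .ofCore (polarInnerCore Q₁ h₁).toCore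
  have hS' : S.IsPositive := ⟨hS.polar_left, hS.nonneg⟩
  have hT' : T.IsPositive := ⟨hT.polar_left, hT.nonneg⟩
  refine hS'.eq_of_comp_self_eq hT' (LinearMap.ext fun v => ext_inner_right ℝ fun w => ?_)
  have key {R : V →ₗ[ℝ] V} (hR : IsPositiveIsometry Q₀ Q₁ R) :
      polar Q₁ (R (R v)) w = polar Q₀ v w := by
    rw [hR.polar_left]
    simp only [polar, ← map_add, hR.map_apply]
  exact (key hS).trans (key hT).symm

theorem PosDef.exists_isPositiveIsometry [FiniteDimensional ℝ V] (h₀ : Q₀.PosDef)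
    (h₁ : Q₁.PosDef) : ∃ S : V →ₗ[ℝ] V, IsPositiveIsometry Q₀ Q₁ S := by
  let : NormedAddCommGroup V := (polarInnerCore Q₁ h₁).toNormedAddCommGroup
  let : InnerProductSpace ℝ V := .ofCore (polarInnerCore Q₁ h₁).toCore
  have hnd : (polarBilin Q₁).Nondegenerate := by
    refine ⟨fun v hv => ?_, fun v hv => ?_⟩ <;>
      exact h₁.anisotropic v (by simpa [polar_self] using hv v)
  obtain ⟨A, hA⟩ : ∃ A : V →ₗ[ℝ] V, ∀ v w, polar Q₁ (A v) w = polar Q₀ v w :=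
    ⟨_, fun v w => LinearMap.BilinForm.symmCompOfNondegenerate_left_apply (polarBilin Q₀) hnd w v⟩
  have hApos : A.IsPositive := by
    refine ⟨fun v w => ?_, fun v => ?_⟩
    · change polar Q₁ (A v) w = polar Q₁ v (A w)
      rw [polar_comm Q₁ v, hA, hA, polar_comm]
    · change 0 ≤ polar Q₁ (A v) v
      rw [hA, polar_self]
      have := h₀.nonneg v
      simpa using this
  obtain ⟨S, hS, hSA⟩ := hApos.exists_isPositive_comp_self_eq
  have hsymm (v w) : polar Q₁ (S v) w = polar Q₁ v (S w) := hS.isSymmetric v w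
  refine ⟨S, hsymm, hS.2, fun v => ?_⟩
  have h := hA v v
  rw [← hSA, LinearMap.comp_apply, hsymm, polar_self, polar_self] at h
  simpa using h

theorem IsPositiveIsometry.injective_lineMap (h₀ : Q₀.PosDef) (h₁ : Q₁.PosDef)
    {S : V →ₗ[ℝ] V} (hS : IsPositiveIsometry Q₀ Q₁ S) {t : ℝ} (ht : t ∈ Icc (0 : ℝ) 1) :
    Function.Injective ((1 - t) • LinearMap.id + t • S : V →ₗ[ℝ] V) := by
  refine (injective_iff_map_eq_zero _).2 fun v hv => ?_
  by_contra hne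
  have hv' : (1 - t) • v + t • S v = 0 := hv
  rcases ht.2.eq_or_lt with rfl | hlt
  · have hSv : S v = 0 := by simpa using hv'
    have := h₀ v hne
    rw [← hS.map_apply, hSv, map_zero] at this
    exact this.false
  · have h : polar Q₁ ((1 - t) • v + t • S v) v = 0 := by rw [hv', polar_zero_left]
    rw [polar_add_left, polar_smul_left, polar_smul_left, polar_self] at h
    have h2 := mul_pos (sub_pos.2 hlt) (h₁ v hne)
    have h3 := mul_nonneg ht.1 (hS.nonneg v)
    simp only [smul_eq_mul, nsmul_eq_mul, Nat.cast_ofNat] at h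
    nlinarith

end Algebra

section Continuity

variable {X F : Type*} [TopologicalSpace X] [NormedAddCommGroup F] [NormedSpace ℝ F]
  [FiniteDimensional ℝ F] {x₀ : X}

theorem eventually_le_mul_norm_sq {Q : X → QuadraticForm ℝ F} {a : ℝ}
    (hQ : ∀ f, ContinuousAt (fun p : X × F => Q p.1 p.2) (x₀, f))
    (ha : ∀ f ∈ Metric.sphere (0 : F) 1, Q x₀ f < a) :
    ∀ᶠ x in 𝓝 x₀, ∀ f, Q x f ≤ a * ‖f‖ ^ 2 := by
  have : ProperSpace F := FiniteDimensional.proper_real F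
  have hK : IsCompact (Metric.sphere (0 : F) 1) := isCompact_sphere _ _
  filter_upwards [hK.eventually_forall_of_forall_eventually (P := fun x f => Q x f < a)
    fun f hf => (hQ f).eventually_lt_const (ha f hf)] with x hx f
  rcases eq_or_ne f 0 with rfl | hf
  · simp
  · have hf' : ‖f‖ ≠ 0 := norm_ne_zero_iff.2 hf
    have h := hx (‖f‖⁻¹ • f) (by simp [norm_smul, hf'])
    have hQf : Q x f = Q x (‖f‖⁻¹ • f) * ‖f‖ ^ 2 := by
      rw [QuadraticMap.map_smul]
      simp only [smul_eq_mul]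
      field_simp
    rw [hQf]
    gcongr

/-- The positive isometry between two continuous families of quadratic forms depends continuously
on the parameter. -/
theorem continuousAt_of_isPositiveIsometry {Q₀ Q₁ : X → QuadraticForm ℝ F}
    (hQ₀ : ∀ f, ContinuousAt (fun p : X × F => Q₀ p.1 p.2) (x₀, f))
    (hQ₁ : ∀ f, ContinuousAt (fun p : X × F => Q₁ p.1 p.2) (x₀, f))
    (hpos : (Q₁ x₀).PosDef) {S : X → F →L[ℝ] F}
    (hS : ∀ᶠ x in 𝓝 x₀, IsPositiveIsometry (Q₀ x) (Q₁ x) (S x)) :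
    ContinuousAt S x₀ := by
  have : ProperSpace F := FiniteDimensional.proper_real F
  have : ProperSpace (F →L[ℝ] F) := FiniteDimensional.proper_real _
  have hK : IsCompact (Metric.sphere (0 : F) 1) := isCompact_sphere _ _
  have hcont {Q : X → QuadraticForm ℝ F}
      (hQ : ∀ f, ContinuousAt (fun p : X × F => Q p.1 p.2) (x₀, f)) : Continuous (Q x₀) :=
    continuous_iff_continuousAt.2 fun f =>
      ContinuousAt.comp (f := fun f : F => (x₀, f)) (hQ f) (by fun_prop)
  obtain ⟨C, hC⟩ := (hK.image (hcont hQ₀)).bddAbove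
  obtain ⟨c, hc, hcle⟩ := hK.exists_forall_le' (hcont hQ₁).continuousOn (a := 0)
    fun f hf => hpos f (ne_zero_of_mem_unit_sphere ⟨f, hf⟩)
  have hupper := eventually_le_mul_norm_sq (a := max C 0 + 1) hQ₀ fun f hf =>
    ((hC (mem_image_of_mem _ hf)).trans (le_max_left _ _)).trans_lt (lt_add_one _)
  have hlower := eventually_le_mul_norm_sq (Q := fun x => -Q₁ x) (a := -(c / 2))
    (fun f => (hQ₁ f).neg) fun f hf => by
      have := hcle f hf
      simp only [neg_apply]
      linarith
  refine (isCompact_closedBall (0 : F →L[ℝ] F)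
    (√((max C 0 + 1) / (c / 2)))).tendsto_nhds_of_unique_mapClusterPt ?_ fun T _ hT => ?_
  · filter_upwards [hS, hupper, hlower] with x hx hu hl
    rw [mem_closedBall_zero_iff]
    refine ContinuousLinearMap.opNorm_le_bound _ (Real.sqrt_nonneg _) fun f => ?_
    refine abs_le_of_sq_le_sq' ?_ (by positivity) |>.2
    rw [mul_pow, Real.sq_sqrt (by positivity), div_mul_eq_mul_div, le_div_iff₀ (by positivity)]
    have h1 := hl (S x f)
    have h2 := hu f
    have h3 : Q₁ x (S x f) = Q₀ x f := hx.map_apply f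
    simp only [neg_apply] at h1
    linarith
  · obtain ⟨U, hU, hUT⟩ := mapClusterPt_iff_ultrafilter.1 hT
    have hUS : ∀ᶠ x in (U : Filter X), IsPositiveIsometry (Q₀ x) (Q₁ x) (S x) := hU hS
    have hlim {Q : X → QuadraticForm ℝ F}
        (hQ : ∀ f, ContinuousAt (fun p : X × F => Q p.1 p.2) (x₀, f)) {g : X → F} {f : F}
        (hg : Tendsto g U (𝓝 f)) : Tendsto (fun x => Q x (g x)) U (𝓝 (Q x₀ f)) :=
      (hQ f).tendsto.comp (Tendsto.prodMk_nhds (tendsto_id.mono_left hU) hg)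
    have hpolar {g h : X → F} {a b : F} (hg : Tendsto g U (𝓝 a)) (hh : Tendsto h U (𝓝 b)) :
        Tendsto (fun x => polar (Q₁ x) (g x) (h x)) U (𝓝 (polar (Q₁ x₀) a b)) :=
      ((hlim hQ₁ (hg.add hh)).sub (hlim hQ₁ hg)).sub (hlim hQ₁ hh)
    have happ (f : F) : Tendsto (fun x => S x f) U (𝓝 (T f)) :=
      ((ContinuousLinearMap.apply ℝ F f).continuous.tendsto T).comp hUT
    have hTiso : IsPositiveIsometry (Q₀ x₀) (Q₁ x₀) T := by
      refine ⟨fun v w => ?_, fun v => ?_, fun v => ?_⟩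
      · exact tendsto_nhds_unique_of_eventuallyEq
          (hpolar (happ v) tendsto_const_nhds) (hpolar tendsto_const_nhds (happ w))
          (hUS.mono fun x hx => hx.polar_left v w)
      · exact ge_of_tendsto (hpolar (happ v) tendsto_const_nhds)
          (hUS.mono fun x hx => hx.nonneg v)
      · exact tendsto_nhds_unique_of_eventuallyEq
          (hlim hQ₁ (happ v)) (hlim hQ₀ tendsto_const_nhds)
          (hUS.mono fun x hx => hx.map_apply v)
    exact ContinuousLinearMap.coe_injective
      (hpos.eq_of_isPositiveIsometry hTiso hS.self_of_nhds)

end Continuity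

end QuadraticMap

/-- Any two continuous fiberwise positive-definite quadratic forms on a vector
bundle are isometric via a gauge transformation lying in the path component of
the identity: there is a continuous map `Φ` on (total space) × [0,1] which is a
gauge transformation at each time, is the identity at time 0, and carries `q₁`
to `q₀` at time 1. -/
theorem positive_definite_isometric_by_gauge_path
    {X : Type*} [TopologicalSpace X]
    {F : Type*} [NormedAddCommGroup F] [NormedSpace ℝ F] [FiniteDimensional ℝ F]
    {E : X → Type*} [∀ x, AddCommGroup (E x)] [∀ x, Module ℝ (E x)]
    [∀ x, TopologicalSpace (E x)] [TopologicalSpace (Bundle.TotalSpace F E)]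
    [FiberBundle F E] [VectorBundle ℝ F E]
    (q₀ q₁ : Bundle.TotalSpace F E → ℝ) (hq₀ : Continuous q₀) (hq₁ : Continuous q₁)
    (Q₀ Q₁ : ∀ x, QuadraticForm ℝ (E x))
    (hQ₀ : ∀ (x : X) (v : E x), q₀ (Bundle.TotalSpace.mk x v) = Q₀ x v)
    (hQ₁ : ∀ (x : X) (v : E x), q₁ (Bundle.TotalSpace.mk x v) = Q₁ x v)
    (hpos₀ : ∀ (x : X) (v : E x), v ≠ 0 → 0 < Q₀ x v)
    (hpos₁ : ∀ (x : X) (v : E x), v ≠ 0 → 0 < Q₁ x v) :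
    ∃ Φ : Bundle.TotalSpace F E × Set.Icc (0 : ℝ) 1 → Bundle.TotalSpace F E,
      Continuous Φ ∧
      (∀ (t : Set.Icc (0 : ℝ) 1) (x : X), ∃ g : E x ≃ₗ[ℝ] E x,
        ∀ v : E x, Φ (Bundle.TotalSpace.mk x v, t) = Bundle.TotalSpace.mk x (g v)) ∧
      (∀ v : Bundle.TotalSpace F E,
        Φ (v, ⟨0, Set.left_mem_Icc.mpr zero_le_one⟩) = v) ∧
      (∀ v : Bundle.TotalSpace F E,
        q₀ v = q₁ (Φ (v, ⟨1, Set.right_mem_Icc.mpr zero_le_one⟩))) := by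
  have hfin (x : X) : FiniteDimensional ℝ (E x) :=
    ((trivializationAt F E x).linearEquivAt ℝ x
      (FiberBundle.mem_baseSet_trivializationAt' x)).symm.finiteDimensional
  choose S hS using fun x =>
    QuadraticMap.PosDef.exists_isPositiveIsometry (Q₀ := Q₀ x) (Q₁ := Q₁ x) (hpos₀ x) (hpos₁ x)
  refine ⟨fun p => ⟨p.1.proj, (1 - (p.2 : ℝ)) • p.1.2 + (p.2 : ℝ) • S p.1.proj p.1.2⟩,
    continuous_iff_continuousAt.2 ?_, fun t x => ?_, fun v => by simp, ?_⟩
  · rintro ⟨⟨x₀, v₀⟩, t₀⟩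
    rw [FiberBundle.continuousAt_totalSpace]
    have hproj : Continuous fun p : Bundle.TotalSpace F E × Icc (0 : ℝ) 1 => p.1.proj :=
      (FiberBundle.continuous_proj F E).comp continuous_fst
    refine ⟨hproj.continuousAt, ?_⟩
    change ContinuousAt (fun p : Bundle.TotalSpace F E × Icc (0 : ℝ) 1 =>
      (trivializationAt F E x₀ ⟨p.1.proj, _⟩).2) _
    set e := trivializationAt F E x₀
    have hx₀ : x₀ ∈ e.baseSet := FiberBundle.mem_baseSet_trivializationAt' x₀
    have hbase : ∀ᶠ x in 𝓝 x₀, x ∈ e.baseSet := e.open_baseSet.mem_nhds hx₀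
    have hcont {q : Bundle.TotalSpace F E → ℝ} (hq : Continuous q)
        {Q : ∀ x, QuadraticForm ℝ (E x)} (hqQ : ∀ (x : X) (v : E x), q ⟨x, v⟩ = Q x v) (f : F) :
        ContinuousAt (fun p : X × F => (Q p.1).comp (e.symmₗ ℝ p.1) p.2) (x₀, f) := by
      have h := e.continuousOn_symm.continuousAt (x := (x₀, f))
        ((e.open_baseSet.prod isOpen_univ).mem_nhds ⟨hx₀, mem_univ _⟩)
      refine (hq.continuousAt.comp h).congr ?_
      filter_upwards [continuousAt_fst.eventually hbase] with p hp
      simp [hqQ, e.symmₗ_apply hp]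
    let S' (x : X) : F →L[ℝ] F :=
      (e.linearMapAt ℝ x ∘ₗ S x ∘ₗ e.symmₗ ℝ x).toContinuousLinearMap
    have hS' : ContinuousAt S' x₀ := by
      refine QuadraticMap.continuousAt_of_isPositiveIsometry
        (Q₀ := fun x => (Q₀ x).comp (e.symmₗ ℝ x))
        (Q₁ := fun x => (Q₁ x).comp (e.symmₗ ℝ x)) (hcont hq₀ hQ₀) (hcont hq₁ hQ₁)
        (fun f hf => hpos₁ x₀ (e.symmₗ ℝ x₀ f) fun h => hf ?_) ?_
      · simpa [h] using (e.linearMapAt_symmₗ (R := ℝ) hx₀ f).symm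
      · filter_upwards [hbase] with x hx
        have hpolar (v w : F) : QuadraticMap.polar ((Q₁ x).comp (e.symmₗ ℝ x)) v w =
            QuadraticMap.polar (Q₁ x) (e.symmₗ ℝ x v) (e.symmₗ ℝ x w) := by
          simp [QuadraticMap.polar]
        have hsymm (v : F) : e.symmₗ ℝ x (S' x v) = S x (e.symmₗ ℝ x v) :=
          e.symmₗ_linearMapAt hx _
        constructor
        · intro v w
          simp only [hpolar, ContinuousLinearMap.coe_coe, hsymm, (hS x).polar_left]
        · intro v
          simp only [hpolar, ContinuousLinearMap.coe_coe, hsymm, (hS x).nonneg]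
        · intro v
          simp only [QuadraticMap.comp_apply, ContinuousLinearMap.coe_coe, hsymm,
            (hS x).map_apply]
    have hfib : ContinuousAt (fun p : Bundle.TotalSpace F E × Icc (0 : ℝ) 1 => (e p.1).2)
        (⟨x₀, v₀⟩, t₀) :=
      ((e.continuousAt (e.mem_source.2 hx₀)).comp continuousAt_fst).snd
    have hS'p : ContinuousAt (fun p : Bundle.TotalSpace F E × Icc (0 : ℝ) 1 => S' p.1.proj)
        (⟨x₀, v₀⟩, t₀) := ContinuousAt.comp (g := S') hS' hproj.continuousAt
    have ht : Continuous fun p : Bundle.TotalSpace F E × Icc (0 : ℝ) 1 => (p.2 : ℝ) := by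
      fun_prop
    refine ((((continuous_const (y := (1 : ℝ))).sub ht).continuousAt.smul hfib).add
      (ht.continuousAt.smul (hS'p.clm_apply hfib))).congr ?_
    filter_upwards [hproj.continuousAt.eventually hbase] with p hp
    have he (v : E p.1.proj) : (e ⟨p.1.proj, v⟩).2 = e.linearMapAt ℝ p.1.proj v := by
      rw [e.linearMapAt_apply, if_pos hp]
    simp [S', he, e.symmₗ_linearMapAt hp]
  · exact ⟨.ofInjectiveEndo _ ((hS x).injective_lineMap (hpos₀ x) (hpos₁ x) t.2), fun v => rfl⟩
  · rintro ⟨x, v⟩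
    simp [hQ₀, hQ₁, (hS x).map_apply]
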